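/- Let F be an algebraically closed field of characteristic 2. Let A_1, A_2, A_3, A_4 and B_1, B_2, B_3, B_4 be 2×2 matrices over F such that tr(A_i) = tr(B_i) and det(A_i) = det(B_i) for all 1 ≤ i ≤ 4, tr(A_i A_j) = tr(B_i B_j) for all 1 ≤ i < j ≤ 4, and tr(A_i A_j A_k) = tr(B_i B_j B_k) for all 1 ≤ i < j < k ≤ 4. If A_1 = [[a, 1], [0, a]] and B_1 = [[b, 1], [0, b]] for some a, b ∈ F, then tr(A_1 A_2 A_3 A_4) = tr(B_1 B_2 B_3 B_4). -/

import Mathlib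

open Matrix

/-- `Y` is the conjugate of `X` by the unipotent matrix `!![1, t; 0, 1]`, in coordinates. -/
def IsUnipotentConj {F : Type*} [Field F] (t : F) (X Y : Matrix (Fin 2) (Fin 2) F) : Prop :=
  Y 1 0 = X 1 0 ∧ Y 0 0 = X 0 0 + t * X 1 0 ∧ Y 1 1 = X 1 1 - t * X 1 0 ∧
    Y 0 1 = X 0 1 + t * (X 1 1 - X 0 0) - t ^ 2 * X 1 0

lemma exists_isUnipotentConj {F : Type*} [Field F] {X Y : Matrix (Fin 2) (Fin 2) F}
    (hc : X 1 0 ≠ 0) (h : X 1 0 = Y 1 0) (hT : X.trace = Y.trace) (hD : X.det = Y.det) :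
    ∃ t, IsUnipotentConj t X Y := by
  simp only [trace_fin_two, det_fin_two] at hT hD
  obtain ⟨t, ht⟩ : ∃ t, Y 0 0 = X 0 0 + t * X 1 0 :=
    ⟨(Y 0 0 - X 0 0) / X 1 0, by field_simp; ring⟩
  have hs : Y 1 1 = X 1 1 - t * X 1 0 := by linear_combination -hT - ht
  refine ⟨t, h.symm, ht, hs, mul_left_cancel₀ hc ?_⟩
  rw [ht, hs, ← h] at hD
  linear_combination hD

lemma IsUnipotentConj.of_trace_mul {F : Type*} [Field F] {t : F}
    {X Y Z W : Matrix (Fin 2) (Fin 2) F} (hXY : IsUnipotentConj t X Y) (hc : X 1 0 ≠ 0)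
    (h : Z 1 0 = W 1 0) (hT : Z.trace = W.trace) (hm : (X * Z).trace = (Y * W).trace)
    (he : (X * Z) 1 0 = (Y * W) 1 0) : IsUnipotentConj t Z W := by
  obtain ⟨h1, h2, h3, h4⟩ := hXY
  simp only [trace_fin_two, mul_apply, Fin.sum_univ_two] at hT hm he
  rw [h1, h3, ← h] at he
  have hp : W 0 0 = Z 0 0 + t * Z 1 0 :=
    mul_left_cancel₀ hc (by linear_combination -he)
  have hs : W 1 1 = Z 1 1 - t * Z 1 0 := by linear_combination -hT - hp
  refine ⟨h.symm, hp, hs, mul_left_cancel₀ hc ?_⟩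
  rw [h1, h2, h3, h4, hp, hs, ← h] at hm
  linear_combination -hm

lemma IsUnipotentConj.of_trace_mul' {F : Type*} [Field F] {t : F}
    {X Y Z W : Matrix (Fin 2) (Fin 2) F} (hXY : IsUnipotentConj t X Y) (hc : X 1 0 ≠ 0)
    (h : Z 1 0 = W 1 0) (hT : Z.trace = W.trace) (hm : (Z * X).trace = (W * Y).trace)
    (he : (Z * X) 1 0 = (W * Y) 1 0) : IsUnipotentConj t Z W := by
  refine hXY.of_trace_mul hc h hT (by rwa [trace_mul_comm X, trace_mul_comm Y]) ?_
  obtain ⟨h1, h2, h3, -⟩ := hXY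
  simp only [trace_fin_two, mul_apply, Fin.sum_univ_two] at hT he ⊢
  rw [h1, h2, ← h] at he
  rw [h1, h3, ← h]
  linear_combination -he + X 1 0 * hT

lemma IsUnipotentConj.mul_mul_apply {F : Type*} [Field F] {t : F}
    {X X' Y Y' Z Z' : Matrix (Fin 2) (Fin 2) F} (hX : IsUnipotentConj t X X')
    (hY : IsUnipotentConj t Y Y') (hZ : IsUnipotentConj t Z Z') :
    (X * Y * Z) 1 0 = (X' * Y' * Z') 1 0 := by
  obtain ⟨x1, -, x3, -⟩ := hX
  obtain ⟨y1, y2, y3, y4⟩ := hY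
  obtain ⟨z1, z2, -, -⟩ := hZ
  simp only [mul_apply, Fin.sum_univ_two, x1, x3, y1, y2, y3, y4, z1, z2]
  ring

lemma trace_jordan_mul {F : Type*} [Field F] (a : F) (X : Matrix (Fin 2) (Fin 2) F) :
    (!![a, 1; 0, a] * X).trace = a * X.trace + X 1 0 := by
  simp only [trace_fin_two, mul_apply, Fin.sum_univ_two, of_apply, cons_val_zero, cons_val_one]
  ring

theorem prop4_case_jordan_jordan_char2
    {F : Type*} [Field F] [IsAlgClosed F] [CharP F 2]
    (A B : Fin 4 → Matrix (Fin 2) (Fin 2) F)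
    (hT : ∀ i : Fin 4, (A i).trace = (B i).trace)
    (hD : ∀ i : Fin 4, (A i).det = (B i).det)
    (hT2 : ∀ i j : Fin 4, i < j → (A i * A j).trace = (B i * B j).trace)
    (hT3 : ∀ i j k : Fin 4, i < j → j < k →
      (A i * A j * A k).trace = (B i * B j * B k).trace)
    (hA1 : ∃ a : F, A 0 = !![a, 1; 0, a])
    (hB1 : ∃ b : F, B 0 = !![b, 1; 0, b]) :
    (A 0 * A 1 * A 2 * A 3).trace = (B 0 * B 1 * B 2 * B 3).trace := by
  obtain ⟨a, ha⟩ := hA1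
  obtain ⟨b, hb⟩ := hB1
  obtain rfl : a = b := by
    have h := hD 0
    rw [ha, hb, det_fin_two_of, det_fin_two_of] at h
    exact CharTwo.sq_injective (by linear_combination h)
  have hc (i : Fin 4) (hi : 0 < i) : A i 1 0 = B i 1 0 := by
    have h := hT2 0 i hi
    rw [ha, hb, trace_jordan_mul, trace_jordan_mul, hT i] at h
    exact add_left_cancel h
  have he (i j : Fin 4) (hi : 0 < i) (hij : i < j) : (A i * A j) 1 0 = (B i * B j) 1 0 := by
    have h := hT3 0 i j hi hij
    rw [ha, hb, mul_assoc, mul_assoc, trace_jordan_mul, trace_jordan_mul, hT2 i j hij] at h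
    exact add_left_cancel h
  suffices h : (A 1 * A 2 * A 3) 1 0 = (B 1 * B 2 * B 3) 1 0 by
    have h3 := hT3 1 2 3 (by decide) (by decide)
    simp only [mul_assoc] at h h3 ⊢
    rw [ha, hb, trace_jordan_mul, trace_jordan_mul, h, h3]
  by_cases hall : ∀ i : Fin 4, 0 < i → A i 1 0 = 0
  · have hB (i : Fin 4) (hi : 0 < i) : B i 1 0 = 0 := hc i hi ▸ hall i hi
    simp [mul_apply, Fin.sum_univ_two, hall, hB]
  · push Not at hall
    obtain ⟨i, hi, hne⟩ := hall
    obtain ⟨t, ht⟩ := exists_isUnipotentConj hne (hc i hi) (hT i) (hD i)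
    have key (j : Fin 4) (hj : 0 < j) : IsUnipotentConj t (A j) (B j) := by
      rcases lt_trichotomy i j with hij | rfl | hji
      · exact ht.of_trace_mul hne (hc j hj) (hT j) (hT2 i j hij) (he i j hi hij)
      · exact ht
      · exact ht.of_trace_mul' hne (hc j hj) (hT j) (hT2 j i hji) (he j i hj hji)
    exact (key 1 (by decide)).mul_mul_apply (key 2 (by decide)) (key 3 (by decide))
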